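/- Let x⁰, s⁰, x*, s*, x, s be vectors in ℝ^n with (x⁰, s⁰) ≥ (x*, s*) ≥ 0, (x, s) ≥ 0, and (x*)ᵀ s* = 0. Suppose η ∈ [0,1] satisfies η ≤ (xᵀs)/((x⁰)ᵀ s⁰), and suppose (x − ηx⁰ − (1−η)x*)ᵀ (s − ηs⁰ − (1−η)s*) = 0. Then η·((x⁰)ᵀ s + (s⁰)ᵀ x) ≤ 3 xᵀ s. -/

import Mathlib

open Matrix

noncomputable def specNorm {m n : ℕ} (A : Matrix (Fin m) (Fin n) ℝ) : ℝ :=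
  ‖LinearMap.toContinuousLinearMap (Matrix.toEuclideanLin A)‖

noncomputable def euclNorm {n : ℕ} (v : Fin n → ℝ) : ℝ := Real.sqrt (∑ i, (v i)^2)

noncomputable def frobNorm {m n : ℕ} (A : Matrix (Fin m) (Fin n) ℝ) : ℝ :=
  Real.sqrt (∑ i, ∑ j, (A i j)^2)

theorem stmt11 {n : ℕ} (x0 s0 xst sst x s : Fin n → ℝ)
    (hxst : ∀ i, 0 ≤ xst i) (hsst : ∀ i, 0 ≤ sst i)
    (hx0 : ∀ i, xst i ≤ x0 i) (hs0 : ∀ i, sst i ≤ s0 i)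
    (hx : ∀ i, 0 ≤ x i) (hs : ∀ i, 0 ≤ s i)
    (hstar : xst ⬝ᵥ sst = 0)
    (hpos : 0 < x0 ⬝ᵥ s0)
    (η : ℝ) (hη0 : 0 ≤ η) (hη1 : η ≤ 1)
    (hηle : η ≤ (x ⬝ᵥ s) / (x0 ⬝ᵥ s0))
    (horth : (x - η • x0 - (1 - η) • xst) ⬝ᵥ (s - η • s0 - (1 - η) • sst) = 0) :
    η * (x0 ⬝ᵥ s + s0 ⬝ᵥ x) ≤ 3 * (x ⬝ᵥ s) := by
  have hx0_nonneg : ∀ i, 0 ≤ x0 i := fun i => (hxst i).trans (hx0 i)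
  have hs0_nonneg : ∀ i, 0 ≤ s0 i := fun i => (hsst i).trans (hs0 i)
  have hgap : η * (x0 ⬝ᵥ s0) ≤ x ⬝ᵥ s := (le_div_iff₀ hpos).mp hηle
  have hx0sst : x0 ⬝ᵥ sst ≤ x0 ⬝ᵥ s0 := dotProduct_le_dotProduct_of_nonneg_left hs0 hx0_nonneg
  have hxsts0 : xst ⬝ᵥ s0 ≤ x0 ⬝ᵥ s0 := dotProduct_le_dotProduct_of_nonneg_right hx0 hs0_nonneg
  have hxsst : 0 ≤ x ⬝ᵥ sst := dotProduct_nonneg_of_nonneg hx hsst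
  have hxsts : 0 ≤ xst ⬝ᵥ s := dotProduct_nonneg_of_nonneg hxst hs
  have hη1' : 0 ≤ 1 - η := sub_nonneg.mpr hη1
  simp only [sub_dotProduct, dotProduct_sub, smul_dotProduct, dotProduct_smul, smul_eq_mul,
    hstar] at horth
  rw [dotProduct_comm s0 x]
  have hcross := mul_le_mul_of_nonneg_left (add_le_add hx0sst hxsts0) (mul_nonneg hη0 hη1')
  have hstar_terms := mul_nonneg hη1' (add_nonneg hxsst hxsts)
  have hsq : 0 ≤ η * η * (x0 ⬝ᵥ s0) := mul_nonneg (mul_self_nonneg η) hpos.le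
  linarith
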